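/- For each fixed integer ℓ ≥ 1 and each n, let ℋ_ℓ be the family of associative trees on n variables whose root has exactly ℓ non-leaf subtrees. Then the limiting ratio μ_n(ℋ_ℓ) exists for every n, and μ_n(ℋ_ℓ) → ℓ/2^{ℓ+1} as n → ∞. -/

import Mathlib

/-- An and/or tree skeleton: leaves carry a variable index and a polarity
(`true` = positive literal, `false` = negated literal); internal nodes carry
a connective (`true` = AND, `false` = OR) and a list of children. -/
inductive AT (n : ℕ) : Type
  | leaf : Fin n → Bool → AT n
  | node : Bool → List (AT n) → AT n

namespace AT

/-- The connective at the root, if the root is an internal node. -/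
def rootConn {n : ℕ} : AT n → Option Bool
  | .leaf _ _ => none
  | .node c _ => some c

/-- Whether a tree is a single leaf. -/
def isLeafB {n : ℕ} : AT n → Bool
  | .leaf _ _ => true
  | .node _ _ => false

/-- The children of the root. -/
def rootChildren {n : ℕ} : AT n → List (AT n)
  | .leaf _ _ => []
  | .node _ ts => ts

/-- Well-formedness: an associative tree is a plane tree in which each internal
node has at least two children, no internal node has the same connective as its
parent (stratification), and leaves carry literals. -/
inductive WF {n : ℕ} : AT n → Prop
  | leaf (i : Fin n) (b : Bool) : WF (.leaf i b)
  | node (c : Bool) (ts : List (AT n)) :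
      2 ≤ ts.length → (∀ t ∈ ts, WF t) → (∀ t ∈ ts, rootConn t ≠ some c) →
      WF (.node c ts)

mutual
/-- The size of a tree: its total number of nodes. -/
def size {n : ℕ} : AT n → ℕ
  | .leaf _ _ => 1
  | .node _ ts => 1 + sizeList ts
def sizeList {n : ℕ} : List (AT n) → ℕ
  | [] => 0
  | t :: ts => size t + sizeList ts
end

mutual
/-- The Boolean function computed by a tree. -/
def eval {n : ℕ} : AT n → (Fin n → Bool) → Bool
  | .leaf i b, x => if b then x i else ! x i
  | .node c ts, x => evalList c ts x
def evalList {n : ℕ} : Bool → List (AT n) → (Fin n → Bool) → Bool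
  | c, [], _ => c
  | c, t :: ts, x => if c then eval t x && evalList c ts x
                     else eval t x || evalList c ts x
end

end AT

open AT

/-- Number of associative trees of size `m` in a family `𝒯`. -/
noncomputable def countIn (n : ℕ) (𝒯 : Set (AT n)) (m : ℕ) : ℕ :=
  Nat.card {t : AT n // t ∈ 𝒯 ∧ WF t ∧ size t = m}

/-- `A n m` is the number of associative trees of size `m` on `n` variables. -/
noncomputable def A (n m : ℕ) : ℕ := countIn n Set.univ m

/-- `Pmn n m f` is the proportion, among associative trees of size `m` on `n`
variables, of those computing the Boolean function `f`. -/
noncomputable def Pmn (n m : ℕ) (f : (Fin n → Bool) → Bool) : ℝ :=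
  (countIn n {t | eval t = f} m : ℝ) / (A n m : ℝ)

/-- Ratio of trees of size `m` in the family `𝒯` among all trees of size `m`. -/
noncomputable def ratio (n : ℕ) (𝒯 : Set (AT n)) (m : ℕ) : ℝ :=
  (countIn n 𝒯 m : ℝ) / (A n m : ℝ)

/-- `HasLimRatio n 𝒯 μ` : the limiting ratio of the family `𝒯` exists and is `μ`. -/
def HasLimRatio (n : ℕ) (𝒯 : Set (AT n)) (μ : ℝ) : Prop :=
  Filter.Tendsto (ratio n 𝒯) Filter.atTop (nhds μ)

/-- Extension of a Boolean function of `n₀` variables to `n ≥ n₀` variables. -/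
def extend {n₀ n : ℕ} (h : n₀ ≤ n) (f : (Fin n₀ → Bool) → Bool) :
    (Fin n → Bool) → Bool :=
  fun x => f (fun j => x (Fin.castLE h j))

open Classical in
/-- The tree size complexity of a Boolean function. -/
noncomputable def Lcomp (n : ℕ) (f : (Fin n → Bool) → Bool) : ℕ :=
  if f = (fun _ => true) ∨ f = (fun _ => false) then 0
  else if ∃ i : Fin n, f = (fun x => x i) ∨ f = (fun x => ! x i) then 2
  else sInf {m | ∃ t : AT n, WF t ∧ size t = m ∧ eval t = f}

/-- The family `ℋ_ℓ` of associative trees whose root has exactly `ℓ` non-leaf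
subtrees. -/
def Hfam (n l : ℕ) : Set (AT n) :=
  {t | ((rootChildren t).filter (fun s => !isLeafB s)).length = l}


open PowerSeries in
/-- Generating function (real coefficients) of a set `S` with size function `f`. -/
noncomputable def gf {α : Type*} (f : α → ℕ) (S : Set α) : PowerSeries ℝ :=
  PowerSeries.mk fun m => (({x | x ∈ S ∧ f x = m}.ncard : ℕ) : ℝ)

theorem gf_coeff {α : Type*} (f : α → ℕ) (S : Set α) (m : ℕ) :
    PowerSeries.coeff m (gf f S) = (({x | x ∈ S ∧ f x = m}.ncard : ℕ) : ℝ) := by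
  simp [gf]

theorem gf_union {α : Type*} (f : α → ℕ) (hf : ∀ m, {x | f x = m}.Finite) (S T : Set α)
    (h : Disjoint S T) : gf f (S ∪ T) = gf f S + gf f T := by
  ext m
  simp only [map_add, gf_coeff]
  rw [← Nat.cast_add, ← Set.ncard_union_eq ?_ ((hf m).subset fun x hx => hx.2)
    ((hf m).subset fun x hx => hx.2)]
  · congr 2
    ext x
    simp only [Set.mem_union, Set.mem_ofPred_eq]
    tauto
  · rw [Set.disjoint_left] at h ⊢
    rintro x ⟨hx, _⟩ ⟨hx', _⟩
    exact h hx hx'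

theorem gf_image_succ {α β : Type*} (f : α → ℕ) (g : β → ℕ) (op : α → β)
    (hop : Function.Injective op) (hs : ∀ a, g (op a) = 1 + f a) (S : Set α) :
    gf g (op '' S) = PowerSeries.X * gf f S := by
  ext m
  cases m with
  | zero =>
    rw [PowerSeries.coeff_zero_X_mul, gf_coeff]
    norm_cast
    convert Set.ncard_empty β
    ext x
    simp only [Set.mem_ofPred_eq, Set.mem_empty_iff_false, iff_false]
    rintro ⟨⟨a, _, rfl⟩, h⟩
    rw [hs] at h
    omega
  | succ m =>
    rw [PowerSeries.coeff_succ_X_mul, gf_coeff, gf_coeff, ← Set.ncard_image_of_injective _ hop]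
    congr 2
    ext x
    constructor
    · rintro ⟨⟨a, ha, rfl⟩, h⟩
      rw [hs] at h
      exact ⟨a, ⟨ha, by omega⟩, rfl⟩
    · rintro ⟨a, ⟨ha, h⟩, rfl⟩
      exact ⟨⟨a, ha, rfl⟩, by rw [hs]; omega⟩

theorem gf_image {α β : Type*} (f : α → ℕ) (g : β → ℕ) (op : α → β)
    (hop : Function.Injective op) (hs : ∀ a, g (op a) = f a) (S : Set α) :
    gf g (op '' S) = gf f S := by
  ext m
  rw [gf_coeff, gf_coeff, ← Set.ncard_image_of_injective _ hop]
  congr 2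
  ext x
  constructor
  · rintro ⟨⟨a, ha, rfl⟩, h⟩
    rw [hs] at h
    exact ⟨a, ⟨ha, by omega⟩, rfl⟩
  · rintro ⟨a, ⟨ha, h⟩, rfl⟩
    exact ⟨⟨a, ha, rfl⟩, by rw [hs]; omega⟩

theorem gf_image2 {α β γ : Type*} (f : α → ℕ) (g : β → ℕ) (h : γ → ℕ)
    (hf : ∀ m, {x | f x = m}.Finite) (hg : ∀ m, {x | g x = m}.Finite)
    (op : α → β → γ)
    (hop : Function.Injective2 op) (hs : ∀ a b, h (op a b) = f a + g b)
    (S : Set α) (T : Set β) :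
    gf h (Set.image2 op S T) = gf f S * gf g T := by
  ext m
  rw [PowerSeries.coeff_mul]
  simp only [gf_coeff]
  have hfin : ∀ p : ℕ × ℕ,
      ({x | x ∈ S ∧ f x = p.1} ×ˢ {x | x ∈ T ∧ g x = p.2} : Set (α × β)).Finite := fun p =>
    ((hf p.1).subset fun x hx => hx.2).prod ((hg p.2).subset fun x hx => hx.2)
  classical
  have h1 : ({x | x ∈ Set.image2 op S T ∧ h x = m} : Set γ) = (Function.uncurry op) ''
      (((Finset.HasAntidiagonal.antidiagonal m).biUnion fun p => (hfin p).toFinset : Finset (α × β)) :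
        Set (α × β)) := by
    ext x
    constructor
    · rintro ⟨⟨a, ha, b, hb, rfl⟩, hx⟩
      rw [hs] at hx
      refine ⟨(a, b), ?_, rfl⟩
      simp [ha, hb, hx]
    · rintro ⟨⟨a, b⟩, hab, rfl⟩
      simp only [Finset.coe_biUnion, Set.mem_iUnion, Finset.mem_coe, Finset.HasAntidiagonal.mem_antidiagonal,
        Set.Finite.mem_toFinset, Set.mem_prod, Set.mem_ofPred_eq] at hab
      obtain ⟨p, hp, ⟨ha, ha'⟩, hb, hb'⟩ := hab
      refine ⟨⟨a, ha, b, hb, rfl⟩, ?_⟩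
      simp only [Function.uncurry]
      rw [hs]; omega
  rw [h1, Set.ncard_image_of_injective _ hop.uncurry, Set.ncard_coe_finset, Finset.card_biUnion]
  · push_cast
    refine Finset.sum_congr rfl fun p _ => ?_
    rw [← Set.ncard_eq_toFinset_card _ (hfin p), Set.ncard_prod]
    push_cast
    rfl
  · intro p _ q _ hpq
    simp only [Function.onFun]
    rw [Finset.disjoint_left]
    rintro ⟨a, b⟩ h1 h2
    simp only [Set.Finite.mem_toFinset, Set.mem_prod, Set.mem_ofPred_eq] at h1 h2
    exact hpq (Prod.ext (h1.1.2.symm.trans h2.1.2) (h1.2.2.symm.trans h2.2.2))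

theorem AT_size_pos {n : ℕ} (t : AT n) : 1 ≤ size t := by
  cases t <;> simp [size]

theorem AT_finite_le (n m : ℕ) :
    {t : AT n | size t ≤ m}.Finite ∧ {ts : List (AT n) | sizeList ts ≤ m}.Finite := by
  have lists : ∀ m, {t : AT n | size t ≤ m}.Finite →
      {ts : List (AT n) | sizeList ts + 1 ≤ m}.Finite →
      {ts : List (AT n) | sizeList ts ≤ m}.Finite := by
    intro m h1 h2
    refine ((Set.finite_singleton []).union (Set.Finite.image2 List.cons h1 h2)).subset ?_
    intro ts hts
    cases ts with
    | nil => left; rfl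
    | cons t ts =>
      right
      simp only [Set.mem_ofPred_eq, sizeList] at hts
      have := AT_size_pos t
      refine ⟨t, ?_, ts, ?_, rfl⟩
      · show size t ≤ m
        omega
      · show sizeList ts + 1 ≤ m
        omega
  induction m with
  | zero =>
    have h0 : {t : AT n | size t ≤ 0}.Finite := by
      convert Set.finite_empty
      ext t
      have := AT_size_pos t
      simp; omega
    refine ⟨h0, lists 0 h0 ?_⟩
    convert Set.finite_empty
    ext t
    simp
  | succ m ih =>
    have h0 : {t : AT n | size t ≤ m + 1}.Finite := by
      refine ((Set.Finite.image2 AT.leaf (Set.finite_univ) (Set.finite_univ)).union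
        (Set.Finite.image2 AT.node (Set.finite_univ) ih.2)).subset ?_
      intro t ht
      cases t with
      | leaf i b => left; exact ⟨i, trivial, b, trivial, rfl⟩
      | node c ts =>
        right
        simp only [Set.mem_ofPred_eq, size] at ht
        exact ⟨c, trivial, ts, by show sizeList ts ≤ m; omega, rfl⟩
    refine ⟨h0, lists _ h0 ?_⟩
    refine ih.2.subset fun t ht => ?_
    simp only [Set.mem_ofPred_eq] at ht ⊢
    omega

theorem AT_fin (n m : ℕ) : {t : AT n | size t = m}.Finite :=
  (AT_finite_le n m).1.subset fun _ ht => le_of_eq ht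

theorem AT_finL (n m : ℕ) : {ts : List (AT n) | sizeList ts = m}.Finite :=
  (AT_finite_le n m).2.subset fun _ ht => le_of_eq ht

/-- Leaves. -/
def LeafS (n : ℕ) : Set (AT n) := {t | isLeafB t = true}
/-- Trees allowed as children of a node labelled `c`. -/
def ChS (n : ℕ) (c : Bool) : Set (AT n) := {t | WF t ∧ rootConn t ≠ some c}
/-- Non-leaf trees allowed as children of a node labelled `c`. -/
def NodS (n : ℕ) (c : Bool) : Set (AT n) := {t | WF t ∧ rootConn t = some (!c)}
/-- Lists of allowed children. -/
def LS (n : ℕ) (c : Bool) : Set (List (AT n)) := {ts | ∀ t ∈ ts, t ∈ ChS n c}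
/-- Lists of allowed children, of length at least two. -/
def LS2 (n : ℕ) (c : Bool) : Set (List (AT n)) := {ts | ts ∈ LS n c ∧ 2 ≤ ts.length}
/-- Lists of allowed children with exactly `k` non-leaves. -/
def LSk (n : ℕ) (c : Bool) (k : ℕ) : Set (List (AT n)) :=
  {ts | ts ∈ LS n c ∧ (ts.filter (fun s => !isLeafB s)).length = k}

theorem gf_nil (n : ℕ) : gf (sizeList (n := n)) {[]} = 1 := by
  ext m
  rw [gf_coeff, PowerSeries.coeff_one]
  split_ifs with h
  · subst h
    norm_cast
    rw [Set.ncard_eq_one]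
    refine ⟨[], ?_⟩
    ext x
    simp only [Set.mem_singleton_iff, Set.mem_ofPred_eq, and_iff_left_iff_imp]
    rintro rfl; rfl
  · norm_cast
    convert Set.ncard_empty (List (AT n))
    ext x
    simp only [Set.mem_singleton_iff, Set.mem_ofPred_eq, Set.mem_empty_iff_false, iff_false]
    rintro ⟨rfl, h'⟩
    exact h h'.symm

theorem gf_leaf (n : ℕ) :
    gf (size (n := n)) (LeafS n) = PowerSeries.C (2 * n : ℝ) * PowerSeries.X := by
  ext m
  rw [gf_coeff, PowerSeries.coeff_C_mul, PowerSeries.coeff_X]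
  split_ifs with h
  · subst h
    have : {x : AT n | x ∈ LeafS n ∧ size x = 1} = Set.range (Function.uncurry AT.leaf) := by
      ext x
      cases x <;> simp [LeafS, isLeafB, size]
    rw [this, ← Set.image_univ, Set.ncard_image_of_injective, Set.ncard_univ]
    · simp [Nat.card_eq_fintype_card]; ring
    · rintro ⟨a, b⟩ ⟨c, d⟩ h
      simpa using h
  · rw [mul_zero]
    norm_cast
    convert Set.ncard_empty (AT n)
    ext x
    simp only [Set.mem_ofPred_eq, Set.mem_empty_iff_false, iff_false]
    rintro ⟨hx, h'⟩
    cases x with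
    | leaf i b => exact h (by simpa [size] using h'.symm)
    | node c ts => simp [LeafS, isLeafB] at hx

theorem ChS_eq (n : ℕ) (c : Bool) : ChS n c = LeafS n ∪ NodS n c := by
  ext t
  cases t with
  | leaf i b => simp [ChS, LeafS, NodS, isLeafB, rootConn, WF.leaf]
  | node d ts => cases c <;> cases d <;> simp [ChS, LeafS, NodS, isLeafB, rootConn]

theorem disj_leaf_nod (n : ℕ) (c : Bool) : Disjoint (LeafS n) (NodS n c) := by
  rw [Set.disjoint_left]
  intro t h1 h2
  cases t <;> simp_all [LeafS, NodS, isLeafB, rootConn]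

theorem gf_ChS (n : ℕ) (c : Bool) :
    gf (size (n := n)) (ChS n c) = gf size (LeafS n) + gf size (NodS n c) := by
  rw [ChS_eq, gf_union _ (AT_fin n) _ _ (disj_leaf_nod n c)]

theorem WF_node_iff {n : ℕ} (c : Bool) (ts : List (AT n)) :
    WF (.node c ts) ↔ ts ∈ LS2 n c := by
  constructor
  · intro h
    cases h with
    | node _ _ h1 h2 h3 => exact ⟨fun t ht => ⟨h2 t ht, h3 t ht⟩, h1⟩
  · rintro ⟨h1, h2⟩
    exact WF.node _ _ h2 (fun t ht => (h1 t ht).1) (fun t ht => (h1 t ht).2)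

theorem node_inj {n : ℕ} (c : Bool) : Function.Injective (AT.node (n := n) c) := by
  intro a b h
  simpa using h

theorem NodS_eq (n : ℕ) (c : Bool) : NodS n c = AT.node (!c) '' LS2 n (!c) := by
  ext t
  cases t with
  | leaf i b => simp [NodS, rootConn]
  | node d ts =>
    simp only [NodS, rootConn, WF_node_iff, Set.mem_ofPred_eq, Set.mem_image, Option.some.injEq,
      AT.node.injEq]
    constructor
    · rintro ⟨h, rfl⟩
      exact ⟨ts, h, rfl, rfl⟩
    · rintro ⟨_, h, rfl, rfl⟩
      exact ⟨h, rfl⟩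

theorem gf_NodS (n : ℕ) (c : Bool) :
    gf (size (n := n)) (NodS n c) = PowerSeries.X * gf sizeList (LS2 n (!c)) := by
  rw [NodS_eq]
  exact gf_image_succ _ _ _ (node_inj _) (fun a => by simp [size]) _

theorem gf_cons {n : ℕ} (S : Set (AT n)) (T : Set (List (AT n))) :
    gf sizeList (Set.image2 List.cons S T) = gf size S * gf sizeList T :=
  gf_image2 _ _ _ (AT_fin n) (AT_finL n) _ (fun a b c d h => by simpa using h)
    (fun a b => by simp [sizeList]) S T

theorem gf_LS (n : ℕ) (c : Bool) :
    gf sizeList (LS n c) = 1 + gf size (ChS n c) * gf sizeList (LS n c) := by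
  rw [← gf_cons, ← gf_nil n, ← gf_union _ (AT_finL n)]
  · congr 1
    ext ts
    cases ts with
    | nil => simp [LS]
    | cons t ts => simp [LS]
  · rw [Set.disjoint_left]
    rintro _ rfl ⟨_, _, _, _, h⟩
    simp at h

theorem gf_LS' (n : ℕ) (c : Bool) :
    gf sizeList (LS n c) = 1 + gf size (ChS n c) + gf sizeList (LS2 n c) := by
  have h1 : gf size (ChS n c) = gf sizeList (Set.image2 List.cons (ChS n c) {[]}) := by
    rw [gf_cons, gf_nil, mul_one]
  rw [h1, ← gf_nil n, ← gf_union _ (AT_finL n), ← gf_union _ (AT_finL n)]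
  · congr 1
    ext ts
    rcases ts with _ | ⟨t, _ | ⟨s, ts⟩⟩ <;> simp [LS, LS2]
  · rw [Set.disjoint_left]
    rintro _ (rfl | ⟨t, ht, _, rfl, rfl⟩) ⟨_, h⟩ <;> simp at h
  · rw [Set.disjoint_left]
    rintro _ rfl ⟨_, _, _, _, h⟩
    simp at h

theorem leaf_mem_ChS {n : ℕ} (c : Bool) {t : AT n} (h : t ∈ LeafS n) : t ∈ ChS n c := by
  rw [ChS_eq]; exact Or.inl h

theorem gf_LSk_zero (n : ℕ) (c : Bool) :
    gf sizeList (LSk n c 0) = 1 + gf size (LeafS n) * gf sizeList (LSk n c 0) := by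
  rw [← gf_cons, ← gf_nil n, ← gf_union _ (AT_finL n)]
  · congr 1
    ext ts
    rcases ts with _ | ⟨t, ts⟩
    · simp [LSk, LS]
    · rcases t with ⟨i, b⟩ | ⟨d, us⟩
      · simp [LSk, LS, isLeafB, LeafS, ChS, WF.leaf, rootConn]
      · simp [LSk, isLeafB, LeafS]
  · rw [Set.disjoint_left]
    rintro _ rfl ⟨_, _, _, _, h⟩
    simp at h

theorem gf_LSk_succ (n : ℕ) (c : Bool) (k : ℕ) :
    gf sizeList (LSk n c (k+1)) = gf size (LeafS n) * gf sizeList (LSk n c (k+1))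
      + gf size (NodS n c) * gf sizeList (LSk n c k) := by
  rw [← gf_cons, ← gf_cons, ← gf_union _ (AT_finL n)]
  · congr 1
    ext ts
    rcases ts with _ | ⟨t, ts⟩
    · simp [LSk]
    · rcases t with ⟨i, b⟩ | ⟨d, us⟩
      · simp [LSk, LS, isLeafB, LeafS, ChS, NodS, WF.leaf, rootConn]
      · have : AT.node d us ∈ ChS n c ↔ AT.node d us ∈ NodS n c := by
          rw [ChS_eq]
          simp [LeafS, isLeafB]
        simp only [LSk, LS, Set.mem_ofPred_eq, List.mem_cons, forall_eq_or_imp, this]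
        simp [LeafS, isLeafB]
        tauto
  · rw [Set.disjoint_left]
    rintro _ ⟨t, ht, ts, _, rfl⟩ ⟨s, hs, _, _, h⟩
    simp only [List.cons.injEq] at h
    rw [h.1] at hs
    exact Set.disjoint_left.1 (disj_leaf_nod n c) ht hs

/-- Lists for the root of a tree in the family. -/
def LSk2 (n : ℕ) (c : Bool) (k : ℕ) : Set (List (AT n)) :=
  {ts | ts ∈ LS2 n c ∧ (ts.filter (fun s => !isLeafB s)).length = k}

theorem gf_LSk2_one (n : ℕ) (c : Bool) :
    gf sizeList (LSk n c 1) = gf size (NodS n c) + gf sizeList (LSk2 n c 1) := by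
  have h1 : gf size (NodS n c) = gf sizeList (Set.image2 List.cons (NodS n c) {[]}) := by
    rw [gf_cons, gf_nil, mul_one]
  rw [h1, ← gf_union _ (AT_finL n)]
  · congr 1
    ext ts
    rcases ts with _ | ⟨t, _ | ⟨s, ts⟩⟩
    · simp [LSk, LSk2]
    · have : t ∈ ChS n c ↔ t ∈ LeafS n ∨ t ∈ NodS n c := by
        rw [ChS_eq]; rfl
      simp only [LSk, LS, Set.mem_ofPred_eq, LSk2, LS2, List.mem_singleton, forall_eq, this]
      rcases t with ⟨i, b⟩ | ⟨d, us⟩ <;> simp [LeafS, isLeafB, NodS, rootConn]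
    · simp [LSk, LSk2, LS2]
  · rw [Set.disjoint_left]
    rintro _ ⟨t, ht, _, rfl, rfl⟩ ⟨⟨_, h⟩, _⟩
    simp at h

theorem LSk2_eq (n : ℕ) (c : Bool) (k : ℕ) (hk : 2 ≤ k) : LSk2 n c k = LSk n c k := by
  ext ts
  simp only [LSk2, LSk, LS2, Set.mem_ofPred_eq]
  constructor
  · rintro ⟨⟨h1, _⟩, h2⟩; exact ⟨h1, h2⟩
  · rintro ⟨h1, h2⟩
    refine ⟨⟨h1, ?_⟩, h2⟩
    have := List.length_filter_le (fun s => !isLeafB s) ts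
    omega

theorem gf_all (n : ℕ) : gf (size (n := n)) {t | WF t}
    = gf size (LeafS n) + gf size (NodS n true) + gf size (NodS n false) := by
  rw [← gf_union _ (AT_fin n) _ _ (disj_leaf_nod n true), ← gf_union _ (AT_fin n)]
  · congr 1
    ext t
    rcases t with ⟨i, b⟩ | ⟨d, us⟩
    · simp [LeafS, isLeafB, WF.leaf]
    · cases d <;> simp [LeafS, isLeafB, NodS, rootConn]
  · rw [Set.disjoint_left]
    rintro t (h | ⟨_, h⟩) ⟨h1, h2⟩
    · cases t <;> simp_all [LeafS, isLeafB, rootConn]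
    · simp_all

theorem gf_H (n l : ℕ) (hl : 1 ≤ l) : gf (size (n := n)) {t | t ∈ Hfam n l ∧ WF t}
    = PowerSeries.X * gf sizeList (LSk2 n true l) +
      PowerSeries.X * gf sizeList (LSk2 n false l) := by
  rw [← gf_image_succ sizeList size _ (node_inj true) (fun a => by simp [size]),
    ← gf_image_succ sizeList size _ (node_inj false) (fun a => by simp [size]),
    ← gf_union _ (AT_fin n)]
  · congr 1
    ext t
    rcases t with ⟨i, b⟩ | ⟨d, us⟩
    · simp [Hfam, rootChildren]; omega
    · cases d <;> simp [Hfam, rootChildren, WF_node_iff, LSk2] <;> tauto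
  · rw [Set.disjoint_left]
    rintro t ⟨_, _, rfl⟩ ⟨_, _, h⟩
    simp at h

theorem A_eq (n m : ℕ) : (A n m : ℝ) = PowerSeries.coeff m (gf (size (n := n)) {t | WF t}) := by
  rw [gf_coeff]
  simp only [A, countIn, Set.mem_univ, true_and]
  rfl

theorem H_eq (n l m : ℕ) : (countIn n (Hfam n l) m : ℝ)
    = PowerSeries.coeff m (gf (size (n := n)) {t | t ∈ Hfam n l ∧ WF t}) := by
  rw [gf_coeff]
  simp only [countIn, Set.mem_ofPred_eq, and_assoc]
  rfl

theorem NodS_const (n : ℕ) (c : Bool) :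
    PowerSeries.constantCoeff (gf (size (n := n)) (NodS n c)) = 0 := by
  rw [gf_NodS]; simp

/-- Summary of the combinatorial part. -/
theorem comb_main (n : ℕ) (l : ℕ) (hl : 1 ≤ l) : ∃ U : PowerSeries ℝ,
    PowerSeries.constantCoeff U = 0 ∧
    (1 - (PowerSeries.C (2 * n : ℝ) * PowerSeries.X + U)) * U
      = PowerSeries.X * (PowerSeries.C (2 * n : ℝ) * PowerSeries.X + U) ^ 2 ∧
    (∀ m, (A n m : ℝ) = PowerSeries.coeff m
      (PowerSeries.C (2 * n : ℝ) * PowerSeries.X + 2 * U)) ∧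
    ∃ H V : PowerSeries ℝ, (∀ m, (countIn n (Hfam n l) m : ℝ) = PowerSeries.coeff m H) ∧
      (1 - PowerSeries.C (2 * n : ℝ) * PowerSeries.X) ^ (l + 1) * V = U ^ l ∧
      H = 2 * PowerSeries.X * V - (if l = 1 then 2 * PowerSeries.X * U else 0) := by
  set Z : PowerSeries ℝ := PowerSeries.C (2 * n : ℝ) * PowerSeries.X with hZ
  have hleaf : gf (size (n := n)) (LeafS n) = Z := gf_leaf n
  have hT := gf_ChS n true
  have hF := gf_ChS n false
  rw [hleaf] at hT hF
  have e1 := gf_LS n true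
  have e2 := gf_LS n false
  have f1 := gf_LS' n true
  have f2 := gf_LS' n false
  have g1 := gf_NodS n true
  have g2 := gf_NodS n false
  simp only [Bool.not_true, Bool.not_false] at g1 g2
  rw [hT] at e1 f1
  rw [hF] at e2 f2
  have c1 := NodS_const n true
  have hsym : gf (size (n := n)) (NodS n true) = gf (size (n := n)) (NodS n false) := by
    generalize gf (size (n := n)) (NodS n true) = U1 at *
    generalize gf (size (n := n)) (NodS n false) = U2 at *
    generalize gf sizeList (LS n true) = L1 at *
    generalize gf sizeList (LS n false) = L2 at *
    generalize gf sizeList (LS2 n true) = M1 at *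
    generalize gf sizeList (LS2 n false) = M2 at *
    have key : (U1 - U2) * (1 + PowerSeries.X * (L1 * L2 - 1)) = 0 := by
      have hL : L2 - L1 = L1 * L2 * (U2 - U1) := by
        linear_combination L1 * e2 - L2 * e1
      have hM1 : M1 = L1 - 1 - Z - U1 := by linear_combination -f1
      have hM2 : M2 = L2 - 1 - Z - U2 := by linear_combination -f2
      rw [hM2] at g1
      rw [hM1] at g2
      linear_combination g1 - g2 + PowerSeries.X * hL
    rcases mul_eq_zero.1 key with h | h
    · exact sub_eq_zero.1 h
    · exfalso
      have := congrArg PowerSeries.constantCoeff h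
      simp at this
  refine ⟨gf (size (n := n)) (NodS n true), c1, ?_, ?_, gf size {t | t ∈ Hfam n l ∧ WF t},
    gf sizeList (LSk n true l), fun m => H_eq n l m, ?_, ?_⟩
  · rw [← hsym] at g2
    generalize gf (size (n := n)) (NodS n true) = U1 at *
    generalize gf sizeList (LS n true) = L1 at *
    generalize gf sizeList (LS2 n true) = M1 at *
    have hM1 : M1 = L1 - 1 - Z - U1 := by linear_combination -f1
    rw [hM1] at g2
    linear_combination (1 - (Z + U1)) * g2 + PowerSeries.X * e1
  · intro m
    rw [A_eq, gf_all, hleaf, ← hsym]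
    ring_nf
  · have : ∀ k, (1 - Z) ^ (k + 1) * gf sizeList (LSk n true k)
        = gf (size (n := n)) (NodS n true) ^ k := by
      intro k
      induction k with
      | zero =>
        have := gf_LSk_zero n true
        rw [hleaf] at this
        linear_combination this
      | succ k ih =>
        have := gf_LSk_succ n true k
        rw [hleaf] at this
        rw [pow_succ (gf _ _), ← ih]
        linear_combination (1 - Z) ^ (k + 1) * this
    exact this l
  · have hV : ∀ k, gf sizeList (LSk n true k) = gf sizeList (LSk n false k) := by
      have hne : (1 - Z) ≠ 0 := by
        intro h
        have := congrArg PowerSeries.constantCoeff h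
        simp [hZ] at this
      intro k
      induction k with
      | zero =>
        have a := gf_LSk_zero n true
        have b := gf_LSk_zero n false
        rw [hleaf] at a b
        apply mul_left_cancel₀ hne
        linear_combination a - b
      | succ k ih =>
        have a := gf_LSk_succ n true k
        have b := gf_LSk_succ n false k
        rw [hleaf] at a b
        rw [ih, hsym] at a
        apply mul_left_cancel₀ hne
        linear_combination a - b
    rw [gf_H n l hl]
    split_ifs with h
    · subst h
      have a := gf_LSk2_one n true
      have b := gf_LSk2_one n false
      rw [← hV, ← hsym] at b
      linear_combination -(PowerSeries.X) * a - PowerSeries.X * b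
    · rw [LSk2_eq _ _ _ (by omega), LSk2_eq _ _ _ (by omega), ← hV]
      ring

theorem psC_two : (2 : PowerSeries ℝ) = PowerSeries.C (2 : ℝ) := (map_ofNat _ 2).symm

theorem psC_four : (4 : PowerSeries ℝ) = PowerSeries.C (4 : ℝ) := (map_ofNat _ 4).symm

/-- Coefficients of `sqrt (1 - z)`. -/
noncomputable def dco : ℕ → ℝ
  | 0 => 1
  | (j + 1) => -2 * (catalan j : ℝ) / 4 ^ (j + 1)

/-- The power series `sqrt (1 - z)`. -/
noncomputable def sq1 : PowerSeries ℝ := PowerSeries.mk dco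

theorem sq1_sq : sq1 ^ 2 = 1 - PowerSeries.X := by
  set K : PowerSeries ℝ := PowerSeries.rescale (1/4 : ℝ)
    (PowerSeries.map (Nat.castRingHom ℝ) PowerSeries.catalanSeries) with hK
  have hC := congrArg (fun F => PowerSeries.rescale (1/4 : ℝ)
    (PowerSeries.map (Nat.castRingHom ℝ) F)) PowerSeries.catalanSeries_sq_mul_X_add_one
  simp only [map_add, map_mul, map_pow, map_one, PowerSeries.map_X, PowerSeries.rescale_X] at hC
  rw [← hK] at hC
  have h1 : sq1 = 1 - 2 * PowerSeries.C (1/4 : ℝ) * PowerSeries.X * K := by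
    ext m
    have h2 : (2 : PowerSeries ℝ) * PowerSeries.C (1/4 : ℝ) * PowerSeries.X * K
        = PowerSeries.X * (PowerSeries.C (1/2 : ℝ) * K) := by
      have : (2 : PowerSeries ℝ) * PowerSeries.C (1/4 : ℝ) = PowerSeries.C (1/2 : ℝ) := by
        rw [psC_two, ← map_mul]
        norm_num
      rw [this]; ring
    rw [h2]
    cases m with
    | zero => simp [sq1, dco]
    | succ m =>
      rw [map_sub, PowerSeries.coeff_succ_X_mul, PowerSeries.coeff_C_mul, hK,
        PowerSeries.coeff_rescale, PowerSeries.coeff_map, PowerSeries.catalanSeries_coeff]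
      simp [sq1, dco, PowerSeries.coeff_one]
      field_simp
      ring
  have hc : (4 : PowerSeries ℝ) * PowerSeries.C (1/4 : ℝ) = 1 := by
    rw [psC_four, ← map_mul]
    norm_num
  rw [h1]
  linear_combination (4 * PowerSeries.C (1/4 : ℝ) * PowerSeries.X) * hC - PowerSeries.X * hc

theorem dco_succ (j : ℕ) : dco (j + 1) * ((j : ℝ) + 1) = dco j * ((j : ℝ) - 1 / 2) := by
  cases j with
  | zero => norm_num [dco]
  | succ j =>
    have h1 := succ_mul_catalan_eq_centralBinom j
    have h2 := succ_mul_catalan_eq_centralBinom (j + 1)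
    have h3 := Nat.succ_mul_centralBinom_succ j
    rw [← h1, ← h2] at h3
    have h4 : ((j : ℝ) + 1) * (((j : ℝ) + 2) * catalan (j + 1))
        = ((j : ℝ) + 1) * (2 * (2 * j + 1) * catalan j) := by
      have := congrArg (Nat.cast (R := ℝ)) h3
      push_cast at this
      linear_combination this
    have h5 := mul_left_cancel₀ (by positivity) h4
    have e : (4 : ℝ) ^ (j + 1 + 1) = 4 * 4 ^ (j + 1) := by ring
    simp only [dco]
    push_cast
    rw [e]
    have h4 : (4 : ℝ) ^ (j + 1) ≠ 0 := by positivity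
    generalize (4 : ℝ) ^ (j + 1) = w at *
    rw [div_mul_eq_mul_div, div_mul_eq_mul_div, div_eq_div_iff (by positivity) h4]
    linear_combination -2 * w * h5

theorem dco_ne (j : ℕ) : dco j ≠ 0 := by
  induction j with
  | zero => simp [dco]
  | succ j ih =>
    intro h
    have h1 := dco_succ j
    rw [h, zero_mul, eq_comm, mul_eq_zero] at h1
    rcases h1 with h1 | h1
    · exact ih h1
    · have : (2 * j : ℝ) = 1 := by linarith
      have : 2 * j = 1 := by exact_mod_cast this
      omega

theorem dco_abs_succ (j : ℕ) : |dco (j + 1)| * ((j : ℝ) + 1) = |dco j| * |(j : ℝ) - 1 / 2| := by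
  rw [← abs_mul, ← dco_succ, abs_mul, abs_of_nonneg (a := (j : ℝ) + 1) (by positivity)]

theorem dco_abs_le (j : ℕ) : |dco j| ≤ 1 := by
  induction j with
  | zero => simp [dco]
  | succ j ih =>
    have h := dco_abs_succ j
    have h1 : |(j : ℝ) - 1 / 2| ≤ (j : ℝ) + 1 := by
      rw [abs_le]; constructor <;> linarith [(Nat.cast_nonneg j : (0 : ℝ) ≤ j)]
    have h2 : |dco j| * |(j : ℝ) - 1 / 2| ≤ 1 * ((j : ℝ) + 1) := by gcongr
    rw [← h] at h2
    exact le_of_mul_le_mul_right h2 (by positivity)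

theorem dco_mono (k : ℕ) (hk : 1 ≤ k) (j : ℕ) :
    (k : ℝ) ^ 2 * |dco k| ≤ ((k + j : ℕ) : ℝ) ^ 2 * |dco (k + j)| := by
  induction j with
  | zero => simp
  | succ j ih =>
    refine ih.trans ?_
    have h := dco_abs_succ (k + j)
    rw [← add_assoc]
    generalize hm : k + j = m at *
    have hm1 : (1 : ℝ) ≤ m := by exact_mod_cast (by omega : 1 ≤ m)
    rw [abs_of_nonneg (a := (m : ℝ) - 1 / 2) (by linarith)] at h
    push_cast
    have h2 : ((m : ℝ) + 1) ^ 2 * |dco (m + 1)| = ((m : ℝ) + 1) * (|dco m| * (m - 1 / 2)) := by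
      rw [← h]; ring
    rw [h2]
    nlinarith [mul_nonneg (abs_nonneg (dco m)) (by linarith : (0 : ℝ) ≤ m / 2 - 1 / 2)]

theorem dco_bound (k j : ℕ) : |dco k| ≤ 2 * ((j : ℝ) + 1) ^ 2 * |dco (k + j)| := by
  have hj0 : (0 : ℝ) ≤ j := Nat.cast_nonneg j
  have key : ∀ k, 1 ≤ k → ∀ j : ℕ, |dco k| ≤ ((j : ℝ) + 1) ^ 2 * |dco (k + j)| := by
    intro k hk j
    have h := dco_mono k hk j
    have hk1 : (1 : ℝ) ≤ k := by exact_mod_cast hk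
    have hj0 : (0 : ℝ) ≤ j := Nat.cast_nonneg j
    have h1 : ((k + j : ℕ) : ℝ) ≤ k * (j + 1) := by push_cast; nlinarith
    have h2 : ((k + j : ℕ) : ℝ) ^ 2 * |dco (k + j)| ≤ (k * (j + 1)) ^ 2 * |dco (k + j)| := by
      gcongr
    have h3 := h.trans h2
    have h4 : (k : ℝ) ^ 2 * |dco k| ≤ (k : ℝ) ^ 2 * (((j : ℝ) + 1) ^ 2 * |dco (k + j)|) := by
      refine h3.trans (le_of_eq ?_); ring
    exact le_of_mul_le_mul_left h4 (by positivity)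
  cases k with
  | succ k =>
    refine (key _ (by omega) j).trans ?_
    have : 0 ≤ ((j : ℝ) + 1) ^ 2 * |dco (k + 1 + j)| := by positivity
    linarith
  | zero =>
    cases j with
    | zero => simp; linarith [abs_nonneg (dco 0)]
    | succ j =>
      have h := key 1 le_rfl j
      have h0 : |dco 0| = 2 * |dco 1| := by norm_num [dco]
      rw [h0, zero_add, add_comm j 1]
      have : ((j : ℝ) + 1) ^ 2 * |dco (1 + j)| ≤ (((1 + j : ℕ) : ℝ) + 1) ^ 2 * |dco (1 + j)| := by
        have : (0 : ℝ) ≤ j := Nat.cast_nonneg j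
        gcongr
        push_cast; linarith
      linarith

theorem dco_ratio_one : Filter.Tendsto (fun m => dco m / dco (m + 1)) Filter.atTop (nhds 1) := by
  have h : ∀ᶠ m : ℕ in Filter.atTop,
      1 + (3 / 2 : ℝ) / ((m : ℝ) + (-1 / 2)) = dco m / dco (m + 1) := by
    filter_upwards [Filter.eventually_ge_atTop 1] with m hm
    have hm1 : (1 : ℝ) ≤ m := by exact_mod_cast hm
    have h := dco_succ m
    have h1 : (m : ℝ) + (-1 / 2) ≠ 0 := by linarith
    rw [eq_div_iff (dco_ne _)]
    have e : 1 + (3 / 2 : ℝ) / ((m : ℝ) + (-1 / 2)) = (m + 1) / ((m : ℝ) + (-1 / 2)) := by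
      rw [eq_div_iff h1, add_mul, div_mul_cancel₀ _ h1]; ring
    rw [e, div_mul_eq_mul_div, div_eq_iff h1]
    linear_combination h
  refine Filter.Tendsto.congr' h ?_
  have : Filter.Tendsto (fun m : ℕ => (3 / 2 : ℝ) / ((m : ℝ) + (-1 / 2))) Filter.atTop (nhds 0) :=
    Filter.Tendsto.const_div_atTop
      (Filter.tendsto_atTop_add_const_right _ _ tendsto_natCast_atTop_atTop) _
  simpa using this.const_add 1

theorem dco_ratio (j : ℕ) :
    Filter.Tendsto (fun m => dco m / dco (m + j)) Filter.atTop (nhds 1) := by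
  induction j with
  | zero =>
    simp [div_self (dco_ne _)]
  | succ j ih =>
    have h1 := ih.mul (dco_ratio_one.comp (Filter.tendsto_add_atTop_nat j))
    rw [mul_one] at h1
    refine h1.congr fun m => ?_
    simp only [Function.comp]
    have := dco_ne (m + j)
    have := dco_ne (m + j + 1)
    rw [← add_assoc]
    field_simp

/-- Series absolutely convergent at radius `R`. -/
def EC (R : ℝ) (F : PowerSeries ℝ) : Prop :=
  Summable fun j => |PowerSeries.coeff j F| * R ^ j

/-- Value of the series at `ρ`. -/
noncomputable def ev (ρ : ℝ) (F : PowerSeries ℝ) : ℝ := ∑' j, PowerSeries.coeff j F * ρ ^ j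

section
variable {R ρ : ℝ}

theorem EC.norm (h0 : 0 ≤ ρ) (h1 : ρ ≤ R) {F : PowerSeries ℝ} (hF : EC R F) :
    Summable fun j => ‖PowerSeries.coeff j F * ρ ^ j‖ := by
  refine Summable.of_nonneg_of_le (fun _ => norm_nonneg _) (fun j => ?_) hF
  rw [norm_mul, Real.norm_eq_abs, Real.norm_eq_abs, abs_of_nonneg (a := ρ ^ j) (by positivity)]
  gcongr

theorem EC.add {F G : PowerSeries ℝ} (h0 : 0 ≤ R) (hF : EC R F) (hG : EC R G) :
    EC R (F + G) := by
  refine Summable.of_nonneg_of_le (fun _ => by positivity) (fun j => ?_) (Summable.add hF hG)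
  rw [map_add, ← add_mul]
  gcongr
  exact abs_add_le _ _

theorem cauchy_term (F G : PowerSeries ℝ) (r : ℝ) (m : ℕ) :
    PowerSeries.coeff m (F * G) * r ^ m = ∑ kl ∈ Finset.HasAntidiagonal.antidiagonal m,
      (PowerSeries.coeff kl.1 F * r ^ kl.1) * (PowerSeries.coeff kl.2 G * r ^ kl.2) := by
  rw [PowerSeries.coeff_mul, Finset.sum_mul]
  refine Finset.sum_congr rfl fun p hp => ?_
  rw [← Finset.HasAntidiagonal.mem_antidiagonal.1 hp, pow_add]
  ring

theorem EC.mul {F G : PowerSeries ℝ} (h0 : 0 ≤ R) (hF : EC R F) (hG : EC R G) :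
    EC R (F * G) := by
  have := summable_norm_sum_mul_antidiagonal_of_summable_norm (hF.norm h0 le_rfl)
    (hG.norm h0 le_rfl)
  refine this.congr fun m => ?_
  rw [← cauchy_term, norm_mul, Real.norm_eq_abs, Real.norm_eq_abs,
    abs_of_nonneg (a := R ^ m) (by positivity)]

theorem ev_mul (h0 : 0 ≤ ρ) (h1 : ρ ≤ R) {F G : PowerSeries ℝ} (hF : EC R F) (hG : EC R G) :
    ev ρ (F * G) = ev ρ F * ev ρ G := by
  unfold ev
  rw [tsum_mul_tsum_eq_tsum_sum_antidiagonal_of_summable_norm (hF.norm h0 h1) (hG.norm h0 h1)]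
  exact tsum_congr fun m => cauchy_term _ _ _ _

theorem ev_add (h0 : 0 ≤ ρ) (h1 : ρ ≤ R) {F G : PowerSeries ℝ} (hF : EC R F) (hG : EC R G) :
    ev ρ (F + G) = ev ρ F + ev ρ G := by
  unfold ev
  rw [← Summable.tsum_add (hF.norm h0 h1).of_norm (hG.norm h0 h1).of_norm]
  refine tsum_congr fun m => ?_
  rw [map_add, add_mul]

theorem EC_C (a : ℝ) : EC R (PowerSeries.C a) := by
  refine summable_of_ne_finset_zero (s := {0}) fun j hj => ?_
  simp at hj
  simp [PowerSeries.coeff_C, hj]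

theorem EC_X : EC R (PowerSeries.X) := by
  refine summable_of_ne_finset_zero (s := {1}) fun j hj => ?_
  simp at hj
  simp [PowerSeries.coeff_X, hj]

theorem ev_C (a : ℝ) : ev ρ (PowerSeries.C a) = a := by
  unfold ev
  rw [tsum_eq_single 0]
  · simp
  · intro j hj
    simp [PowerSeries.coeff_C, hj]

theorem ev_X : ev ρ (PowerSeries.X) = ρ := by
  unfold ev
  rw [tsum_eq_single 1]
  · simp
  · intro j hj
    simp [PowerSeries.coeff_X, hj]

theorem EC_of_geom (h0 : 0 ≤ R) (a : ℝ) (ha : |a| * R < 1) (F : PowerSeries ℝ)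
    (hF : ∀ j, |PowerSeries.coeff j F| ≤ |a| ^ j) : EC R F := by
  refine Summable.of_nonneg_of_le (fun _ => by positivity) (fun j => ?_)
    (summable_geometric_of_lt_one (by positivity) ha)
  rw [mul_pow]
  gcongr
  exact hF j

/-- The geometric series `1/(1 - a z)`. -/
noncomputable def geo (a : ℝ) : PowerSeries ℝ := PowerSeries.mk fun j => a ^ j

theorem geo_mul (a : ℝ) : (1 - PowerSeries.C a * PowerSeries.X) * geo a = 1 := by
  ext m
  rw [sub_mul, one_mul, mul_assoc, map_sub, PowerSeries.coeff_C_mul]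
  cases m with
  | zero => simp [geo]
  | succ m =>
    rw [PowerSeries.coeff_succ_X_mul]
    simp [geo, PowerSeries.coeff_one]
    ring

theorem EC_geo (h0 : 0 ≤ R) (a : ℝ) (ha : |a| * R < 1) : EC R (geo a) :=
  EC_of_geom h0 a ha _ fun j => by simp [geo]

theorem EC_sq (h0 : 0 ≤ R) (a : ℝ) (ha : |a| * R < 1) : EC R (PowerSeries.rescale a sq1) :=
  EC_of_geom h0 a ha _ fun j => by
    rw [PowerSeries.coeff_rescale, abs_mul, abs_pow]
    simp only [sq1, PowerSeries.coeff_mk]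
    exact mul_le_of_le_one_right (by positivity) (dco_abs_le j)

theorem sq_sq (a : ℝ) :
    (PowerSeries.rescale a sq1) ^ 2 = 1 - PowerSeries.C a * PowerSeries.X := by
  rw [← map_pow, sq1_sq, map_sub, map_one, PowerSeries.rescale_X]

theorem one_sub_eq (a : ℝ) : (1 - PowerSeries.C a * PowerSeries.X : PowerSeries ℝ)
    = PowerSeries.C 1 + PowerSeries.C (-a) * PowerSeries.X := by
  simp [sub_eq_add_neg]

theorem EC_lin (h0 : 0 ≤ R) (a : ℝ) :
    EC R (1 - PowerSeries.C a * PowerSeries.X : PowerSeries ℝ) := by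
  rw [one_sub_eq]
  exact (EC_C _).add h0 ((EC_C _).mul h0 EC_X)

theorem ev_lin (h0 : 0 ≤ ρ) (h1 : ρ ≤ R) (a : ℝ) :
    ev ρ (1 - PowerSeries.C a * PowerSeries.X : PowerSeries ℝ) = 1 - a * ρ := by
  have hR := h0.trans h1
  rw [one_sub_eq, ev_add h0 h1 (EC_C _) ((EC_C _).mul hR EC_X), ev_mul h0 h1 (EC_C _) EC_X,
    ev_C, ev_C, ev_X]
  ring

theorem ev_geo (h0 : 0 ≤ ρ) (h1 : ρ ≤ R) (a : ℝ) (ha : |a| * R < 1) :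
    (1 - a * ρ) * ev ρ (geo a) = 1 := by
  have hR := h0.trans h1
  rw [← ev_lin h0 h1, ← ev_mul h0 h1 (EC_lin hR _) (EC_geo hR _ ha), geo_mul]
  simpa using ev_C (ρ := ρ) 1

theorem ev_sq (h0 : 0 ≤ ρ) (h1 : ρ ≤ R) (a : ℝ) (ha : |a| * R < 1) :
    ev ρ (PowerSeries.rescale a sq1) ^ 2 = 1 - a * ρ := by
  have hR := h0.trans h1
  rw [← ev_lin h0 h1, ← sq_sq, pow_two, pow_two, ev_mul h0 h1 (EC_sq hR _ ha) (EC_sq hR _ ha)]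

/-- `F = G + s K` with `G, K` analytic beyond `ρ = 1/α`, and values `g`, `k` at `ρ`. -/
def PF (R ρ α : ℝ) (F : PowerSeries ℝ) (g k : ℝ) : Prop :=
  ∃ G K : PowerSeries ℝ, EC R G ∧ EC R K ∧ F = G + PowerSeries.rescale α sq1 * K ∧
    ev ρ G = g ∧ ev ρ K = k

variable {α : ℝ}

theorem PF.of_EC {F : PowerSeries ℝ} (hF : EC R F) : PF R ρ α F (ev ρ F) 0 :=
  ⟨F, PowerSeries.C 0, hF, EC_C 0, by simp, rfl, ev_C 0⟩

theorem PF.add (h0 : 0 ≤ ρ) (h1 : ρ ≤ R) {F F' : PowerSeries ℝ} {g k g' k' : ℝ}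
    (h : PF R ρ α F g k) (h' : PF R ρ α F' g' k') : PF R ρ α (F + F') (g + g') (k + k') := by
  have hR := h0.trans h1
  obtain ⟨G, K, hG, hK, rfl, rfl, rfl⟩ := h
  obtain ⟨G', K', hG', hK', rfl, rfl, rfl⟩ := h'
  exact ⟨G + G', K + K', hG.add hR hG', hK.add hR hK', by ring, ev_add h0 h1 hG hG',
    ev_add h0 h1 hK hK'⟩

theorem PF.mul (h0 : 0 ≤ ρ) (h1 : ρ ≤ R) (hα : α * ρ = 1) {F F' : PowerSeries ℝ}
    {g k g' k' : ℝ} (h : PF R ρ α F g k) (h' : PF R ρ α F' g' k') :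
    PF R ρ α (F * F') (g * g') (g * k' + k * g') := by
  have hR := h0.trans h1
  obtain ⟨G, K, hG, hK, rfl, rfl, rfl⟩ := h
  obtain ⟨G', K', hG', hK', rfl, rfl, rfl⟩ := h'
  have e := EC_lin hR α
  refine ⟨G * G' + (1 - PowerSeries.C α * PowerSeries.X) * (K * K'), G * K' + K * G',
    (hG.mul hR hG').add hR (e.mul hR (hK.mul hR hK')),
    (hG.mul hR hK').add hR (hK.mul hR hG'), ?_, ?_, ?_⟩
  · rw [← sq_sq]; ring
  · rw [ev_add h0 h1 (hG.mul hR hG') (e.mul hR (hK.mul hR hK')), ev_mul h0 h1 hG hG',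
      ev_mul h0 h1 e (hK.mul hR hK'), ev_lin h0 h1, hα]
    ring
  · rw [ev_add h0 h1 (hG.mul hR hK') (hK.mul hR hG'), ev_mul h0 h1 hG hK', ev_mul h0 h1 hK hG']

theorem PF.pow (h0 : 0 ≤ ρ) (h1 : ρ ≤ R) (hα : α * ρ = 1) {F : PowerSeries ℝ}
    {g k : ℝ} (h : PF R ρ α F g k) (l : ℕ) :
    PF R ρ α (F ^ (l + 1)) (g ^ (l + 1)) ((l + 1) * g ^ l * k) := by
  induction l with
  | zero => simpa using h
  | succ l ih =>
    have := ih.mul h0 h1 hα h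
    rw [pow_succ F, pow_succ g (l + 1)]
    convert this using 1
    push_cast
    ring

theorem EC.weight (h0 : 0 < ρ) (h1 : ρ < R) {F : PowerSeries ℝ} (hF : EC R F) :
    Summable fun j : ℕ => |PowerSeries.coeff j F| * ρ ^ j * (2 * ((j : ℝ) + 1) ^ 2) := by
  have hR := h0.trans h1
  have hq : |ρ / R| < 1 := by
    rw [abs_of_pos (by positivity), div_lt_one hR]; exact h1
  have ht : Filter.Tendsto (fun j : ℕ => 2 * ((j : ℝ) ^ 2 * (ρ / R) ^ j + 2 * ((j : ℝ) ^ 1 * (ρ / R) ^ j)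
      + (j : ℝ) ^ 0 * (ρ / R) ^ j)) Filter.atTop (nhds (2 * (0 + 2 * 0 + 0))) :=
    (((tendsto_pow_const_mul_const_pow_of_abs_lt_one 2 hq).add
      ((tendsto_pow_const_mul_const_pow_of_abs_lt_one 1 hq).const_mul 2)).add
      (tendsto_pow_const_mul_const_pow_of_abs_lt_one 0 hq)).const_mul 2
  obtain ⟨M, hM⟩ := ht.bddAbove_range
  refine Summable.of_nonneg_of_le (fun _ => by positivity) (fun j => ?_)
    (Summable.mul_left M hF)
  have hj := hM ⟨j, rfl⟩
  simp only at hj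
  have e : |PowerSeries.coeff j F| * ρ ^ j * (2 * ((j : ℝ) + 1) ^ 2) =
      (2 * ((j : ℝ) ^ 2 * (ρ / R) ^ j + 2 * ((j : ℝ) ^ 1 * (ρ / R) ^ j)
      + (j : ℝ) ^ 0 * (ρ / R) ^ j)) * (|PowerSeries.coeff j F| * R ^ j) := by
    rw [div_pow]
    field_simp
    ring
  rw [e]
  gcongr

theorem coeff_s (m : ℕ) : PowerSeries.coeff m (PowerSeries.rescale α sq1) = α ^ m * dco m := by
  rw [PowerSeries.coeff_rescale]; simp [sq1]

theorem c_ratio (hα : α * ρ = 1) (k j : ℕ) :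
    (α ^ k * dco k) / (α ^ (k + j) * dco (k + j)) = ρ ^ j * (dco k / dco (k + j)) := by
  have ha : α ≠ 0 := left_ne_zero_of_mul_eq_one hα
  have hρ : ρ = 1 / α := by field_simp; linarith
  have := dco_ne (k + j)
  rw [hρ, div_pow, one_pow, pow_add]
  field_simp

theorem c_ratio_le (h0 : 0 < ρ) (k j : ℕ) :
    |ρ ^ j * (dco k / dco (k + j))| ≤ ρ ^ j * (2 * ((j : ℝ) + 1) ^ 2) := by
  rw [abs_mul, abs_div, abs_of_pos (a := ρ ^ j) (by positivity)]
  have : |dco k| / |dco (k + j)| ≤ 2 * ((j : ℝ) + 1) ^ 2 := by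
    rw [div_le_iff₀ (abs_pos.2 (dco_ne _))]
    exact dco_bound k j
  gcongr

theorem transfer_G (h0 : 0 < ρ) (h1 : ρ < R) (hα : α * ρ = 1) {G : PowerSeries ℝ}
    (hG : EC R G) : Filter.Tendsto (fun m => PowerSeries.coeff m G / (α ^ m * dco m))
      Filter.atTop (nhds 0) := by
  refine squeeze_zero_norm (fun m => ?_) (hG.weight h0 h1).tendsto_atTop_zero
  have h := c_ratio_le h0 0 m
  rw [← c_ratio hα 0 m] at h
  have hd : dco 0 = 1 := rfl
  simp only [pow_zero, hd, zero_add, mul_one] at h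
  rw [div_eq_mul_one_div, norm_mul, Real.norm_eq_abs, Real.norm_eq_abs, mul_assoc]
  gcongr

theorem transfer_K (h0 : 0 < ρ) (h1 : ρ < R) (hα : α * ρ = 1) {K : PowerSeries ℝ}
    (hK : EC R K) : Filter.Tendsto
      (fun m => PowerSeries.coeff m (PowerSeries.rescale α sq1 * K) / (α ^ m * dco m))
      Filter.atTop (nhds (ev ρ K)) := by
  have key := tendsto_tsum_of_dominated_convergence (𝓕 := Filter.atTop)
    (f := fun m j : ℕ => if j ≤ m then
      PowerSeries.coeff j K * ((α ^ (m - j) * dco (m - j)) / (α ^ m * dco m)) else 0)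
    (g := fun j => PowerSeries.coeff j K * ρ ^ j) (hK.weight h0 h1) ?_ ?_
  · refine key.congr fun m => ?_
    rw [tsum_eq_sum (s := Finset.range (m + 1))]
    · rw [mul_comm (PowerSeries.rescale α sq1), PowerSeries.coeff_mul,
        Finset.Nat.sum_antidiagonal_eq_sum_range_succ_mk, Finset.sum_div]
      refine Finset.sum_congr rfl fun j hj => ?_
      rw [if_pos (by simp at hj; omega), coeff_s]
      ring
    · intro j hj
      rw [if_neg (by simp at hj; omega)]
  · intro j
    have h := ((dco_ratio j).const_mul (ρ ^ j)).const_mul (PowerSeries.coeff j K)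
    rw [mul_one] at h
    rw [← Filter.tendsto_add_atTop_iff_nat j]
    refine h.congr fun m => ?_
    rw [if_pos (by omega), Nat.add_sub_cancel, c_ratio hα]
  · refine Filter.Eventually.of_forall fun m j => ?_
    split_ifs with h
    · obtain ⟨k, rfl⟩ := Nat.exists_eq_add_of_le' h
      rw [Nat.add_sub_cancel, c_ratio hα, norm_mul, Real.norm_eq_abs, Real.norm_eq_abs, mul_assoc]
      have := c_ratio_le h0 k j
      gcongr
    · rw [norm_zero]; positivity

theorem PF.transfer (h0 : 0 < ρ) (h1 : ρ < R) (hα : α * ρ = 1) {F : PowerSeries ℝ} {g k : ℝ}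
    (h : PF R ρ α F g k) : Filter.Tendsto (fun m => PowerSeries.coeff m F / (α ^ m * dco m))
      Filter.atTop (nhds k) := by
  obtain ⟨G, K, hG, hK, rfl, rfl, rfl⟩ := h
  have := (transfer_G h0 h1 hα hG).add (transfer_K h0 h1 hα hK)
  rw [zero_add] at this
  refine this.congr fun m => ?_
  rw [map_add, add_div]

theorem PF.ratio (h0 : 0 < ρ) (h1 : ρ < R) (hα : α * ρ = 1) {F F' : PowerSeries ℝ}
    {g k g' k' : ℝ} (h : PF R ρ α F g k) (h' : PF R ρ α F' g' k') (hk : k' ≠ 0) :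
    Filter.Tendsto (fun m => PowerSeries.coeff m F / PowerSeries.coeff m F')
      Filter.atTop (nhds (k / k')) := by
  refine ((h.transfer h0 h1 hα).div (h'.transfer h0 h1 hα) hk).congr fun m => ?_
  have h2 : α ^ m * dco m ≠ 0 :=
    mul_ne_zero (pow_ne_zero _ (left_ne_zero_of_mul_eq_one hα)) (dco_ne m)
  exact div_div_div_cancel_right₀ h2 _ _

end

/-- The singular expansion of the generating function of non-leaf trees. -/
theorem PF_U (n : ℕ) (hn : 1 ≤ n) (U : PowerSeries ℝ) (hU0 : PowerSeries.constantCoeff U = 0)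
    (hU : (1 - (PowerSeries.C (2 * n : ℝ) * PowerSeries.X + U)) * U
      = PowerSeries.X * (PowerSeries.C (2 * n : ℝ) * PowerSeries.X + U) ^ 2)
    (q ρ R : ℝ) (hq : 0 < q) (hqn : q ^ 2 = 2 * n) (hρ : ρ = 1 / (q * (q + 2)))
    (h1 : ρ < R) (hR : R * q ^ 2 < 1) :
    ∃ k ≠ 0, PF R ρ (q * (q + 2)) U (q / ((q + 1) * (q + 2))) k := by
  have hn1 : (1 : ℝ) ≤ n := by exact_mod_cast hn
  have hq2 : 2 ≤ q ^ 2 := by rw [hqn]; linarith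
  have hq1 : 1 < q := by nlinarith
  have h0 : 0 < ρ := by rw [hρ]; positivity
  have hRpos : 0 < R := h0.trans h1
  have hα : q * (q + 2) * ρ = 1 := by rw [hρ]; field_simp
  have hb : |q * (q - 2)| * R < 1 := by
    have : |q * (q - 2)| ≤ q ^ 2 := by
      rw [abs_le]; constructor <;> nlinarith
    calc |q * (q - 2)| * R ≤ q ^ 2 * R := by gcongr
      _ < 1 := by linarith
  have hm1 : |(-1 : ℝ)| * R < 1 := by
    rw [abs_neg, abs_one]; nlinarith
  rw [← hqn] at hU
  set w := PowerSeries.rescale (q * (q - 2)) sq1 with hw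
  set s := PowerSeries.rescale (q * (q + 2)) sq1 with hs
  set Z : PowerSeries ℝ := PowerSeries.C (q ^ 2) * PowerSeries.X with hZ
  have hw2 : w ^ 2 = 1 - PowerSeries.C (q * (q - 2)) * PowerSeries.X := sq_sq _
  have hs2 : s ^ 2 = 1 - PowerSeries.C (q * (q + 2)) * PowerSeries.X := sq_sq _
  have hprod : (s * w) ^ 2 = (1 + Z) ^ 2 - 4 * (1 + PowerSeries.X) * Z := by
    rw [mul_pow, hw2, hs2, hZ]
    simp only [map_mul, map_add, map_sub, map_pow]
    rw [← psC_two]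
    ring
  have hsq : (2 * (1 + PowerSeries.X) * (Z + U) - (1 + Z)) ^ 2 = (s * w) ^ 2 := by
    rw [hprod]
    linear_combination -4 * (1 + PowerSeries.X) * hU
  have hdco0 : dco 0 = 1 := rfl
  have hs0 : PowerSeries.constantCoeff s = 1 := by
    rw [← PowerSeries.coeff_zero_eq_constantCoeff_apply, coeff_s]; simp [hdco0]
  have hw0 : PowerSeries.constantCoeff w = 1 := by
    rw [← PowerSeries.coeff_zero_eq_constantCoeff_apply, coeff_s]; simp [hdco0]
  have hT : 2 * (1 + PowerSeries.X) * (Z + U) - (1 + Z) = -(s * w) := by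
    rcases sq_eq_sq_iff_eq_or_eq_neg.1 hsq with h | h
    · exfalso
      have := congrArg PowerSeries.constantCoeff h
      simp [hs0, hw0, hU0, hZ] at this
      norm_num at this
    · exact h
  set J := geo (-1) with hJ
  have hJ1 : (1 + PowerSeries.X) * J = 1 := by
    have := geo_mul (-1)
    rw [← hJ] at this
    simpa using this
  have hhalf : (2 : PowerSeries ℝ) * PowerSeries.C (1/2 : ℝ) = 1 := by
    rw [psC_two, ← map_mul]
    norm_num
  have hUeq : U = (PowerSeries.C (1/2 : ℝ) * (J * (1 - PowerSeries.C (-q ^ 2) * PowerSeries.X)) +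
      PowerSeries.C (-q ^ 2) * PowerSeries.X) + s * (PowerSeries.C (-(1/2) : ℝ) * (J * w)) := by
    have e1 : PowerSeries.C (-q ^ 2) * PowerSeries.X = -Z := by rw [hZ]; simp
    have e2 : PowerSeries.C (-(1/2) : ℝ) = -PowerSeries.C (1/2 : ℝ) := by simp
    rw [e1, e2]
    linear_combination PowerSeries.C (1/2 : ℝ) * J * hT
      - (1 + PowerSeries.X) * J * (Z + U) * hhalf - (Z + U) * hJ1
  have hev : (1 + ρ) * ev ρ J = 1 := by
    have := ev_geo h0.le h1.le (-1) hm1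
    rw [← hJ] at this
    linarith
  have hevw : ev ρ w ^ 2 = 1 - q * (q - 2) * ρ := ev_sq h0.le h1.le _ hb
  have hevw0 : ev ρ w ≠ 0 := by
    intro h
    rw [h] at hevw
    have : q * (q - 2) * ρ < 1 := by
      rw [← hα]
      have : q * (q - 2) < q * (q + 2) := by nlinarith
      gcongr
    norm_num at hevw
    linarith
  have hevJ0 : ev ρ J ≠ 0 := right_ne_zero_of_mul_eq_one hev
  have eJ : EC R J := EC_geo hRpos.le _ hm1
  have ew : EC R w := EC_sq hRpos.le _ hb
  have eL := EC_lin hRpos.le (-q ^ 2)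
  have eC := fun a => EC_C (R := R) a
  have eX : EC R PowerSeries.X := EC_X
  have eA := (eC (1/2)).mul hRpos.le (eJ.mul hRpos.le eL)
  have eB := (eC (-q ^ 2)).mul hRpos.le eX
  have eD := (eC (-(1/2))).mul hRpos.le (eJ.mul hRpos.le ew)
  refine ⟨-(1/2) * (ev ρ J * ev ρ w), ?_, _, _, eA.add hRpos.le eB, eD, hUeq, ?_, ?_⟩
  · exact mul_ne_zero (by norm_num) (mul_ne_zero hevJ0 hevw0)
  · rw [ev_add h0.le h1.le eA eB, ev_mul h0.le h1.le (eC _) (eJ.mul hRpos.le eL),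
      ev_mul h0.le h1.le eJ eL, ev_mul h0.le h1.le (eC _) eX, ev_lin h0.le h1.le, ev_C, ev_C, ev_X]
    have hJv : ev ρ J = 1 / (1 + ρ) := by
      field_simp; linarith
    rw [hJv, hρ]
    have : q * (q + 2) + 1 ≠ 0 := by positivity
    have h3 : 1 + 1 / (q * (q + 2)) = (q + 1) ^ 2 / (q * (q + 2)) := by field_simp; ring
    rw [h3]
    field_simp
    ring
  · rw [ev_mul h0.le h1.le (eC _) (eJ.mul hRpos.le ew), ev_mul h0.le h1.le eJ ew, ev_C]

/-- The limiting ratio as a function of `q = sqrt (2 n)`. -/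
noncomputable def muq (l : ℕ) (q : ℝ) : ℝ :=
  (l : ℝ) / 2 ^ (l + 1) * (q / (q + 1)) ^ (l - 1) * ((q + 2) / q)
    - (if l = 1 then 1 / (q * (q + 2)) else 0)

theorem lim_n (l : ℕ) (hl : 1 ≤ l) (n : ℕ) (hn : 1 ≤ n) :
    HasLimRatio n (Hfam n l) (muq l (Real.sqrt (2 * n))) := by
  obtain ⟨U, hU0, hU, hA, H, V, hH, hV, hHV⟩ := comb_main n l hl
  set q := Real.sqrt (2 * n) with hqdef
  have hn1 : (1 : ℝ) ≤ n := by exact_mod_cast hn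
  have hqn : q ^ 2 = 2 * n := Real.sq_sqrt (by positivity)
  have hq : 0 < q := Real.sqrt_pos.2 (by positivity)
  set ρ := 1 / (q * (q + 2)) with hρ
  have hlt : ρ < 1 / q ^ 2 := by
    rw [hρ]
    apply one_div_lt_one_div_of_lt (by positivity)
    nlinarith
  obtain ⟨R, h1, hR⟩ := exists_between hlt
  have hR' : R * q ^ 2 < 1 := by
    rwa [lt_div_iff₀ (by positivity)] at hR
  have h0 : 0 < ρ := by rw [hρ]; positivity
  have hRpos : 0 < R := h0.trans h1
  have hα : q * (q + 2) * ρ = 1 := by rw [hρ]; field_simp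
  obtain ⟨k, hk, hPU⟩ := PF_U n hn U hU0 hU q ρ R hq hqn hρ h1 hR'
  have hPC : ∀ a, PF R ρ (q * (q + 2)) (PowerSeries.C a) a 0 := fun a => by
    have := PF.of_EC (ρ := ρ) (α := q * (q + 2)) (EC_C (R := R) a)
    rwa [ev_C] at this
  have hPX : PF R ρ (q * (q + 2)) PowerSeries.X ρ 0 := by
    have := PF.of_EC (ρ := ρ) (α := q * (q + 2)) (EC_X (R := R))
    rwa [ev_X] at this
  have hPA := ((hPC (2 * n)).mul h0.le h1.le hα hPX).add h0.le h1.le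
    ((hPC 2).mul h0.le h1.le hα hPU)
  have hN : |(2 * n : ℝ)| * R < 1 := by
    rw [abs_of_nonneg (by positivity), ← hqn]; linarith
  have hgeo := PF.of_EC (ρ := ρ) (α := q * (q + 2)) (EC_geo hRpos.le (2 * n : ℝ) hN)
  have hgev := ev_geo h0.le h1.le (2 * n : ℝ) hN
  have hgval : ev ρ (geo (2 * n : ℝ)) = (q + 2) / 2 := by
    rw [← hqn, hρ] at hgev ⊢
    have h3 : 1 - q ^ 2 * (1 / (q * (q + 2))) = 2 / (q + 2) := by field_simp; ring
    rw [h3] at hgev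
    field_simp at hgev ⊢
    linarith
  rw [hgval] at hgeo
  obtain ⟨l, rfl⟩ : ∃ l', l = l' + 1 := ⟨l - 1, by omega⟩
  have hVeq : V = geo (2 * n : ℝ) ^ (l + 1 + 1) * U ^ (l + 1) := by
    have h2 : geo (2 * n : ℝ) ^ (l + 1 + 1)
        * (1 - PowerSeries.C (2 * n : ℝ) * PowerSeries.X) ^ (l + 1 + 1) = 1 := by
      rw [← mul_pow, mul_comm, geo_mul, one_pow]
    rw [← hV, ← mul_assoc, h2, one_mul]
  have hPV := (hgeo.pow h0.le h1.le hα (l + 1)).mul h0.le h1.le hα (hPU.pow h0.le h1.le hα l)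
  rw [← hVeq] at hPV
  have hPH := (((hPC 2).mul h0.le h1.le hα hPX).mul h0.le h1.le hα hPV).add h0.le h1.le
    (((hPC (if l + 1 = 1 then -2 else 0)).mul h0.le h1.le hα hPX).mul h0.le h1.le hα hPU)
  have hHeq : H = PowerSeries.C 2 * PowerSeries.X * V
      + PowerSeries.C (if l + 1 = 1 then -2 else 0) * PowerSeries.X * U := by
    rw [hHV]
    split_ifs <;> simp [sub_eq_add_neg, psC_two]
  rw [← hHeq] at hPH
  have hAeq : PowerSeries.C (2 * n : ℝ) * PowerSeries.X + 2 * U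
      = PowerSeries.C (2 * n : ℝ) * PowerSeries.X + PowerSeries.C 2 * U := by rw [psC_two]
  have hfin := hPH.ratio h0 h1 hα hPA (by simpa using hk)
  unfold HasLimRatio
  refine Filter.Tendsto.congr (f₁ := fun m => PowerSeries.coeff m H / PowerSeries.coeff m
    (PowerSeries.C (2 * n : ℝ) * PowerSeries.X + PowerSeries.C 2 * U)) (fun m => ?_) ?_
  · unfold _root_.ratio
    rw [hA, hH, hAeq]
  · convert hfin using 2
    unfold muq
    rw [hρ]
    simp only [Nat.add_sub_cancel, div_pow, mul_pow]
    push_cast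
    split_ifs with h
    · field_simp
      ring
    · field_simp
      ring

theorem lim_q (l : ℕ) :
    Filter.Tendsto (muq l) Filter.atTop (nhds ((l : ℝ) / 2 ^ (l + 1))) := by
  have hid : Filter.Tendsto (fun q : ℝ => q) Filter.atTop Filter.atTop := Filter.tendsto_id
  have t1 : Filter.Tendsto (fun q : ℝ => (-1) / (q + 1)) Filter.atTop (nhds 0) :=
    Filter.Tendsto.const_div_atTop (Filter.tendsto_atTop_add_const_right _ _ hid) _
  have t2 : Filter.Tendsto (fun q : ℝ => 2 / q) Filter.atTop (nhds 0) :=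
    Filter.Tendsto.const_div_atTop hid _
  have t3 : Filter.Tendsto (fun q : ℝ => 1 / (q * (q + 2))) Filter.atTop (nhds 0) :=
    Filter.Tendsto.const_div_atTop
      (hid.atTop_mul_atTop₀ (Filter.tendsto_atTop_add_const_right _ _ hid)) _
  have t4 : Filter.Tendsto (fun q : ℝ => if l = 1 then 1 / (q * (q + 2)) else 0)
      Filter.atTop (nhds 0) := by
    split_ifs
    · exact t3
    · exact tendsto_const_nhds
  have t := ((((t1.const_add 1).pow (l - 1)).const_mul ((l : ℝ) / 2 ^ (l + 1))).mul
    (t2.const_add 1)).sub t4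
  simp only [add_zero, one_pow, mul_one, sub_zero] at t
  refine t.congr' ?_
  filter_upwards [Filter.eventually_gt_atTop 0] with q hq
  unfold muq
  have e1 : 1 + (-1) / (q + 1) = q / (q + 1) := by field_simp; ring
  have e2 : 1 + 2 / q = (q + 2) / q := by field_simp
  rw [e1, e2]

theorem lim_zero (l : ℕ) (hl : 1 ≤ l) : HasLimRatio 0 (Hfam 0 l) 0 := by
  obtain ⟨U, hU0, hU, hA, -⟩ := comb_main 0 l hl
  have hUz : U = 0 := by
    simp only [Nat.cast_zero, mul_zero, map_zero, zero_mul, zero_add] at hU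
    have : U * ((1 - U) - PowerSeries.X * U) = 0 := by linear_combination hU
    rcases mul_eq_zero.1 this with h | h
    · exact h
    · have := congrArg PowerSeries.constantCoeff h
      simp [hU0] at this
  have hA0 : ∀ m, (A 0 m : ℝ) = 0 := by
    intro m
    rw [hA, hUz]; simp
  unfold HasLimRatio
  refine tendsto_const_nhds.congr fun m => ?_
  unfold ratio
  rw [hA0, div_zero]

open Filter in
/-- For each fixed `ℓ ≥ 1`, the limiting ratio `μ_n(ℋ_ℓ)` exists for every `n` and
tends to `ℓ/2^{ℓ+1}` as `n → ∞`. -/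
theorem statement12 (l : ℕ) (hl : 1 ≤ l) :
    ∃ μ : ℕ → ℝ, (∀ n : ℕ, HasLimRatio n (Hfam n l) (μ n)) ∧
      Tendsto (fun n : ℕ => μ n) atTop (nhds ((l : ℝ) / 2 ^ (l + 1))) := by
  refine ⟨fun n => if n = 0 then 0 else muq l (Real.sqrt (2 * n)), fun n => ?_, ?_⟩
  · rcases Nat.eq_zero_or_pos n with rfl | hn
    · simpa using lim_zero l hl
    · simp only [if_neg hn.ne']
      exact lim_n l hl n hn
  · have h1 : Tendsto (fun n : ℕ => Real.sqrt (2 * n)) atTop atTop :=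
      Real.tendsto_sqrt_atTop.comp
        (tendsto_natCast_atTop_atTop.const_mul_atTop (by norm_num : (0 : ℝ) < 2))
    refine ((lim_q l).comp h1).congr' ?_
    filter_upwards [eventually_gt_atTop 0] with n hn
    simp [hn.ne']
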